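/- arXiv:2111.13561 — 2 statements merged into one kernel-verified Lean document; each statement's English description precedes it below -/
import Mathlib

section
/- Let K be a nontrivial proper finitely generated subgroup of a free group F_A with Stallings automaton S(K) = (Q, A, δ, q₀). Let R be the set of nonempty reduced words over Ã and let E be the set of idempotents of {δ_u : u ∈ R} ⊆ M(K), ordered by the natural partial order of the inverse monoid M(K). Let k be the length of a maximal chain in E. Then K is malnormal in F_A if and only if k = 2 and |E| = |Q| + 1. -/
/-- Reading a word over `Ã = A × Bool` from a state of a partial deterministic automaton. -/
def readWord {Q A : Type} (δ : Q → A × Bool → Option Q) : Q → List (A × Bool) → Option Q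
  | q, [] => some q
  | q, x :: w =>
    match δ q x with
    | none => none
    | some q' => readWord δ q' w

/-- The partial transformation `δ_w` as an element of `Function.End (Option Q)`. -/
def ptrans {Q A : Type} (δ : Q → A × Bool → Option Q) (w : List (A × Bool)) :
    Function.End (Option Q) :=
  fun oq => oq.bind fun q => readWord δ q w

/-- The set `E` of idempotents among the `δ_u` for `u` a nonempty reduced word. -/
def idemSet {Q A : Type} [DecidableEq A] (δ : Q → A × Bool → Option Q) :
    Set (Function.End (Option Q)) :=
  {m | ∃ u : List (A × Bool), u ≠ [] ∧ FreeGroup.reduce u = u ∧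
        m = ptrans δ u ∧ m * m = m}

section Words

open FreeGroup (invRev IsCyclicallyReduced)

variable {A : Type}

/-- Two reduced words concatenate to a reduced word iff no cancellation occurs at the junction. -/
theorem isReduced_append_iff {u v : List (A × Bool)} :
    FreeGroup.IsReduced (u ++ v) ↔ FreeGroup.IsReduced u ∧ FreeGroup.IsReduced v ∧
      ∀ a ∈ (invRev u).head?, a ∉ v.head? := by
  unfold FreeGroup.IsReduced
  rw [List.isChain_append]
  refine and_congr_right fun _ => and_congr_right fun _ => ?_
  simp only [invRev, List.head?_reverse, List.getLast?_map, Option.mem_def, Option.map_eq_some_iff]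
  constructor
  · rintro h a ⟨⟨x, b⟩, hx, rfl⟩ ha
    simpa using h _ hx _ ha
  · rintro h ⟨x, b⟩ hx ⟨y, c⟩ hy (rfl : x = y)
    by_contra hbc
    refine h _ ⟨_, hx, rfl⟩ ?_
    rw [hy]
    cases b <;> cases c <;> simp_all

theorem isReduced_invRev {u : List (A × Bool)} (h : FreeGroup.IsReduced u) :
    FreeGroup.IsReduced (invRev u) := by
  rw [FreeGroup.isReduced_iff_not_step] at h ⊢
  intro L hL
  exact h _ (by simpa using hL.invRev)

theorem invRev_ne_nil {u : List (A × Bool)} (h : u ≠ []) : invRev u ≠ [] := by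
  simpa [invRev] using h

theorem eq_of_not_isReduced_pair {x y : A × Bool} (h : ¬ FreeGroup.IsReduced [x, y]) :
    y = (x.1, !x.2) := by
  rw [FreeGroup.isReduced_cons_cons] at h
  obtain ⟨x1, x2⟩ := x
  obtain ⟨y1, y2⟩ := y
  simp only [FreeGroup.IsReduced.singleton, and_true, Classical.not_imp] at h
  obtain ⟨rfl, h⟩ := h
  cases x2 <;> cases y2 <;> simp_all

theorem isReduced_append_self {c : List (A × Bool)} (hc : IsCyclicallyReduced c) :
    FreeGroup.IsReduced (c ++ c) := by
  simpa [List.replicate] using (hc.flatten_replicate 2).isReduced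

theorem head?_invRev (w : List (A × Bool)) :
    (invRev w).head? = w.getLast?.map fun x => (x.1, !x.2) := by
  simp [invRev]

theorem isCyclicallyReduced_invRev {c : List (A × Bool)} (hc : IsCyclicallyReduced c) :
    IsCyclicallyReduced (invRev c) := by
  refine ⟨isReduced_invRev hc.isReduced, ?_⟩
  intro a ha b hb hab
  rw [head?_invRev, Option.mem_def, Option.map_eq_some_iff] at hb
  obtain ⟨y, hy, rfl⟩ := hb
  have h1 := head?_invRev (invRev c)
  rw [FreeGroup.invRev_invRev, ha] at h1
  have := hc.2 y hy _ h1 hab.symm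
  simp [this]

/-- A nonempty cyclically reduced word has distinct first letter and inverse of last letter. -/
theorem head?_ne_of_isCyclicallyReduced {c : List (A × Bool)} (hc : IsCyclicallyReduced c)
    (hne : c ≠ []) : c.head? ≠ (invRev c).head? := by
  have h2 := isReduced_append_self hc
  intro h
  rw [isReduced_append_iff, ← h] at h2
  obtain ⟨a, ha⟩ := Option.ne_none_iff_exists'.1 (mt List.head?_eq_none_iff.1 hne)
  exact h2.2.2 a ha ha

/-- Multiplying by a high power of a cyclically reduced word `c` absorbs any cancellation:
the product can be represented by a reduced word that can be followed by `c` without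
cancellation. -/
theorem exists_isReduced_mul_pow {c : List (A × Bool)} (hc : IsCyclicallyReduced c)
    (hne : c ≠ []) (v : List (A × Bool)) :
    ∃ (N : ℕ) (w : List (A × Bool)), w ≠ [] ∧ FreeGroup.IsReduced w ∧ w.getLast? = c.getLast? ∧
      FreeGroup.mk w = FreeGroup.mk v * FreeGroup.mk c ^ N := by
  induction v with
  | nil => exact ⟨1, c, hne, hc.isReduced, rfl, by simp [← FreeGroup.one_eq_mk]⟩
  | cons x v ih =>
    obtain ⟨N, w, hw, hwr, hl, he⟩ := ih
    have hx : FreeGroup.mk (x :: v) = FreeGroup.mk [x] * FreeGroup.mk v := by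
      simp [FreeGroup.mul_mk]
    by_cases hxw : FreeGroup.IsReduced (x :: w)
    · refine ⟨N, x :: w, by simp, hxw, ?_, ?_⟩
      · rw [← hl, List.getLast?_cons_of_ne_nil hw]
      · rw [hx, mul_assoc, ← he]
        simp [FreeGroup.mul_mk]
    · obtain ⟨y, w, rfl⟩ := List.exists_cons_of_ne_nil hw
      have hy : y = (x.1, !x.2) := eq_of_not_isReduced_pair fun h => hxw <|
        FreeGroup.IsReduced.append_overlap (L₁ := [x]) (L₂ := [y]) h hwr (by simp)
      have hxy : FreeGroup.mk [x] * FreeGroup.mk (y :: w) = FreeGroup.mk w := by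
        rw [FreeGroup.mul_mk, hy]
        exact Quot.sound (FreeGroup.Red.Step.not (L₁ := []))
      by_cases hw0 : w = []
      · subst hw0
        refine ⟨N + 1, c, hne, hc.isReduced, rfl, ?_⟩
        rw [pow_succ, hx, mul_assoc, ← mul_assoc (FreeGroup.mk v), ← he, ← mul_assoc, hxy]
        simp [← FreeGroup.one_eq_mk]
      · refine ⟨N, w, hw0, hwr.infix (List.suffix_cons _ _).isInfix, ?_, ?_⟩
        · rw [← hl, List.getLast?_cons_of_ne_nil hw0]
        · rw [hx, mul_assoc, ← he, hxy]

/-- Every nonempty reduced word is a conjugate of a nonempty cyclically reduced word. -/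
theorem exists_eq_conj_isCyclicallyReduced [DecidableEq A] {u : List (A × Bool)} (hu : u ≠ [])
    (hr : FreeGroup.IsReduced u) :
    ∃ s c : List (A × Bool), c ≠ [] ∧ IsCyclicallyReduced c ∧ s ++ c ++ invRev s = u := by
  have hconj := FreeGroup.reduceCyclically.conj_conjugator_reduceCyclically u
  refine ⟨_, _, fun h => ?_, FreeGroup.reduceCyclically.isCyclicallyReduced hr, hconj⟩
  rw [h, List.append_nil] at hconj
  rw [← hconj, isReduced_append_iff] at hr
  rcases hs : (invRev (FreeGroup.reduceCyclically.conjugator u)).head? with _ | a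
  · rw [List.head?_eq_none_iff] at hs
    rw [hs, List.append_nil] at hconj
    rw [hconj] at hs
    exact invRev_ne_nil hu hs
  · exact hr.2.2 a hs hs

end Words

section Automaton

open FreeGroup (invRev Red IsCyclicallyReduced)

variable {A Q : Type} {δ : Q → A × Bool → Option Q}

theorem readWord_cons (q : Q) (x : A × Bool) (w : List (A × Bool)) :
    readWord δ q (x :: w) = (δ q x).bind fun p => readWord δ p w := by
  rw [readWord]
  cases δ q x <;> rfl

theorem readWord_singleton (q : Q) (x : A × Bool) : readWord δ q [x] = δ q x := by
  rw [readWord_cons]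
  cases δ q x <;> rfl

theorem readWord_append (q : Q) (u v : List (A × Bool)) :
    readWord δ q (u ++ v) = (readWord δ q u).bind fun p => readWord δ p v := by
  induction u generalizing q with
  | nil => rfl
  | cons x u ih =>
    simp only [List.cons_append, readWord_cons, Option.bind_assoc, ih]

theorem readWord_append_eq_some {p r : Q} {u v : List (A × Bool)} :
    readWord δ p (u ++ v) = some r ↔ ∃ q, readWord δ p u = some q ∧ readWord δ q v = some r := by
  rw [readWord_append, Option.bind_eq_some_iff]

/-- Letters act by partial injections, inverse letters by the inverse partial injections. -/
def IsInverseAutomaton (δ : Q → A × Bool → Option Q) : Prop :=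
  ∀ (p q : Q) (a : A) (b : Bool), δ p (a, b) = some q ↔ δ q (a, !b) = some p

theorem readWord_invRev (hinv : IsInverseAutomaton δ) {p q : Q} {w : List (A × Bool)} :
    readWord δ p (invRev w) = some q ↔ readWord δ q w = some p := by
  induction w generalizing p q with
  | nil => simp [readWord, eq_comm]
  | cons x w ih =>
    rw [FreeGroup.invRev_cons, readWord_append_eq_some, readWord_cons, Option.bind_eq_some_iff]
    simp only [ih]
    refine exists_congr fun r => ?_
    rw [and_comm]
    refine and_congr_left fun _ => ?_
    simp only [invRev, List.map_cons, List.map_nil, List.reverse_singleton]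
    rw [readWord_singleton, hinv q r]

theorem readWord_injective (hinv : IsInverseAutomaton δ) {p p' q : Q} {w : List (A × Bool)}
    (h : readWord δ p w = some q) (h' : readWord δ p' w = some q) : p = p' := by
  rw [← readWord_invRev hinv] at h h'
  exact Option.some.inj (h.symm.trans h')

theorem readWord_of_red (hinv : IsInverseAutomaton δ)
    {p q : Q} {u v : List (A × Bool)} (h : Red u v)
    (hu : readWord δ p u = some q) : readWord δ p v = some q := by
  induction h with
  | refl => exact hu
  | tail _ hs ih =>
    obtain @⟨L₁, L₂, x, b⟩ := hs
    obtain ⟨r, h1, h2⟩ := readWord_append_eq_some.1 ih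
    rw [readWord_cons, Option.bind_eq_some_iff] at h2
    obtain ⟨s, h2, h3⟩ := h2
    rw [readWord_cons, (hinv _ _ _ _).1 h2] at h3
    exact readWord_append_eq_some.2 ⟨r, h1, h3⟩

theorem readWord_conj (hinv : IsInverseAutomaton δ) {p q : Q} {x : A × Bool} {u : List (A × Bool)} :
    readWord δ p (x :: u ++ invRev [x]) = some q ↔
      ∃ p' q', δ p x = some p' ∧ δ q x = some q' ∧ readWord δ p' u = some q' := by
  rw [readWord_append_eq_some]
  simp only [readWord_invRev hinv, readWord_singleton]
  simp only [readWord_cons, Option.bind_eq_some_iff]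
  clear hinv
  grind

/-- The partial transformation `δ_w` is a restriction of the identity. -/
def IsSubId (δ : Q → A × Bool → Option Q) (w : List (A × Bool)) : Prop :=
  ∀ p q, readWord δ p w = some q → p = q

theorem IsSubId.readWord_invRev (hinv : IsInverseAutomaton δ)
    {w : List (A × Bool)} (h : IsSubId δ w) (p q : Q) :
    readWord δ p (invRev w) = some q ↔ readWord δ p w = some q := by
  rw [_root_.readWord_invRev hinv]
  constructor
  · intro hq
    obtain rfl := h _ _ hq
    exact hq
  · intro hq
    obtain rfl := h _ _ hq
    exact hq

theorem IsSubId.invRev (hinv : IsInverseAutomaton δ)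
    {w : List (A × Bool)} (h : IsSubId δ w) : IsSubId δ (invRev w) :=
  fun p q hq => h p q ((h.readWord_invRev hinv p q).1 hq)

theorem IsSubId.conj (hinv : IsInverseAutomaton δ)
    {c : List (A × Bool)} (h : IsSubId δ c) (s : List (A × Bool)) :
    IsSubId δ (s ++ c ++ FreeGroup.invRev s) := by
  intro p q hq
  obtain ⟨b, h1, h2⟩ := readWord_append_eq_some.1 hq
  obtain ⟨a, h3, h4⟩ := readWord_append_eq_some.1 h1
  obtain rfl := h _ _ h4
  exact readWord_injective hinv h3 ((_root_.readWord_invRev hinv).1 h2)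

theorem readWord_replicate_of_loop {p : Q} {c : List (A × Bool)} (h : readWord δ p c = some p)
    (n : ℕ) : readWord δ p (List.replicate n c).flatten = some p := by
  induction n with
  | zero => rfl
  | succ n ih =>
    rw [List.replicate_succ, List.flatten_cons]
    exact readWord_append_eq_some.2 ⟨p, h, ih⟩

theorem flatten_replicate_add (m n : ℕ) (c : List (A × Bool)) :
    (List.replicate (m + n) c).flatten =
      (List.replicate m c).flatten ++ (List.replicate n c).flatten := by
  rw [List.replicate_add, List.flatten_append]

theorem flatten_replicate_mul (m n : ℕ) (c : List (A × Bool)) :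
    (List.replicate (n * m) c).flatten =
      (List.replicate n (List.replicate m c).flatten).flatten := by
  induction n with
  | zero => simp
  | succ n ih =>
    rw [Nat.succ_mul, Nat.add_comm, flatten_replicate_add, ih, List.replicate_succ,
      List.flatten_cons]

/-- The power of exponent `|Q|!` of any word acts as an idempotent. -/
theorem isSubId_replicate_factorial (hinv : IsInverseAutomaton δ)
    [Fintype Q] (c : List (A × Bool)) :
    IsSubId δ (List.replicate (Fintype.card Q).factorial c).flatten := by
  intro p q hq
  have hdef : ∀ k : Fin (Fintype.card Q + 1), ∃ r,
      readWord δ p (List.replicate k c).flatten = some r := by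
    intro k
    have hk : (k : ℕ) ≤ (Fintype.card Q).factorial :=
      (Nat.le_of_lt_succ k.2).trans (Nat.self_le_factorial _)
    obtain ⟨m, hm⟩ := Nat.exists_eq_add_of_le hk
    rw [hm, flatten_replicate_add] at hq
    obtain ⟨r, hr, -⟩ := readWord_append_eq_some.1 hq
    exact ⟨r, hr⟩
  choose f hf using hdef
  obtain ⟨i, j, hij, hfe⟩ : ∃ i j : Fin (Fintype.card Q + 1), i < j ∧ f i = f j := by
    obtain ⟨i, j, hne, he⟩ := Fintype.exists_ne_map_eq_of_card_lt f (by simp)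
    rcases lt_or_gt_of_ne hne with h | h
    · exact ⟨i, j, h, he⟩
    · exact ⟨j, i, h, he.symm⟩
  obtain ⟨d, hd⟩ := Nat.exists_eq_add_of_le (show (i : ℕ) ≤ j from hij.le)
  have hd0 : 0 < d := by
    have : (i : ℕ) < j := hij
    omega
  have hdle : d ≤ Fintype.card Q := by
    have := j.2
    omega
  have hj := hf j
  rw [hd, Nat.add_comm, flatten_replicate_add] at hj
  obtain ⟨s, hs, hs'⟩ := readWord_append_eq_some.1 hj
  obtain rfl : s = p := readWord_injective hinv hs' (hfe ▸ hf i)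
  obtain ⟨k, hk⟩ := Nat.dvd_factorial hd0 hdle
  have := readWord_replicate_of_loop hs k
  rw [← flatten_replicate_mul, Nat.mul_comm, ← hk, hq] at this
  exact (Option.some.inj this).symm

/-- Every loop of a nonempty reduced word is a loop of a conjugate of a cyclically reduced word
acting as an idempotent. -/
theorem exists_isSubId_conj (hinv : IsInverseAutomaton δ)
    [Fintype Q] [DecidableEq A] {u : List (A × Bool)} (hu : u ≠ [])
    (hr : FreeGroup.IsReduced u) :
    ∃ s c : List (A × Bool), c ≠ [] ∧ IsCyclicallyReduced c ∧ IsSubId δ c ∧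
      FreeGroup.IsReduced (s ++ c ++ invRev s) ∧
      ∀ p, readWord δ p u = some p → readWord δ p (s ++ c ++ invRev s) = some p := by
  obtain ⟨s, c, hc0, hc, rfl⟩ := exists_eq_conj_isCyclicallyReduced hu hr
  have hM : (Fintype.card Q).factorial ≠ 0 := Nat.factorial_ne_zero _
  refine ⟨s, (List.replicate (Fintype.card Q).factorial c).flatten, ?_,
    hc.flatten_replicate _, isSubId_replicate_factorial hinv c, ?_, ?_⟩
  · obtain ⟨m, hm⟩ := Nat.exists_eq_succ_of_ne_zero hM
    simp [hm, List.replicate_succ, hc0]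
  · exact FreeGroup.IsReduced.append_flatten_replicate_append hc hr hM
  · intro p hp
    obtain ⟨b, h1, h2⟩ := readWord_append_eq_some.1 hp
    obtain ⟨a, h3, h4⟩ := readWord_append_eq_some.1 h1
    have h5 := (readWord_invRev hinv).1 h2
    obtain rfl : a = b := Option.some.inj (h3.symm.trans h5)
    exact readWord_append_eq_some.2
      ⟨a, readWord_append_eq_some.2 ⟨a, h3, readWord_replicate_of_loop h4 _⟩, h2⟩

/-- Two idempotent reduced words whose end letters are not all the same outgoing letter have a
reduced word acting as their product. -/
theorem exists_inf_of_ends_ne (hinv : IsInverseAutomaton δ)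
    {u v : List (A × Bool)} (hu : u ≠ []) (hv : v ≠ [])
    (hur : FreeGroup.IsReduced u) (hvr : FreeGroup.IsReduced v)
    (hus : IsSubId δ u) (hvs : IsSubId δ v)
    (hends : ¬ (u.head? = v.head? ∧ u.head? = (invRev v).head? ∧
      (invRev u).head? = v.head? ∧ (invRev u).head? = (invRev v).head?)) :
    ∃ w : List (A × Bool), w ≠ [] ∧ FreeGroup.IsReduced w ∧
      (∀ a, a ∈ w.head? ∨ a ∈ (invRev w).head? →
        a ∈ u.head? ∨ a ∈ (invRev u).head? ∨ a ∈ v.head? ∨ a ∈ (invRev v).head?) ∧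
      ∀ p q, readWord δ p w = some q ↔ readWord δ p u = some q ∧ readWord δ p v = some q := by
  by_contra hcon
  have key : ∀ u' v' : List (A × Bool), (u' = u ∨ u' = invRev u) → (v' = v ∨ v' = invRev v) →
      (invRev u').head? = v'.head? := by
    intro u' v' hu' hv'
    by_contra hne
    have hu0 : u' ≠ [] := by
      rcases hu' with rfl | rfl
      exacts [hu, invRev_ne_nil hu]
    have hv0 : v' ≠ [] := by
      rcases hv' with rfl | rfl
      exacts [hv, invRev_ne_nil hv]
    refine hcon ⟨u' ++ v', by simp [hu0], ?_, ?_, ?_⟩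
    · rw [isReduced_append_iff]
      refine ⟨?_, ?_, fun a ha hb => hne (ha.trans hb.symm)⟩
      · rcases hu' with rfl | rfl
        exacts [hur, isReduced_invRev hur]
      · rcases hv' with rfl | rfl
        exacts [hvr, isReduced_invRev hvr]
    · intro a
      rw [FreeGroup.invRev_append, List.head?_append_of_ne_nil _ hu0,
        List.head?_append_of_ne_nil _ (invRev_ne_nil hv0)]
      rcases hu' with rfl | rfl <;> rcases hv' with rfl | rfl <;>
        (try simp only [FreeGroup.invRev_invRev]) <;> tauto
    · intro p q
      have h1 : ∀ p q, readWord δ p u' = some q ↔ readWord δ p u = some q := by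
        rcases hu' with rfl | rfl
        exacts [fun _ _ => Iff.rfl, hus.readWord_invRev hinv]
      have h2 : ∀ p q, readWord δ p v' = some q ↔ readWord δ p v = some q := by
        rcases hv' with rfl | rfl
        exacts [fun _ _ => Iff.rfl, hvs.readWord_invRev hinv]
      rw [readWord_append_eq_some]
      simp only [h1, h2]
      constructor
      · rintro ⟨r, h3, h4⟩
        obtain rfl := hus _ _ h3
        obtain rfl := hvs _ _ h4
        exact ⟨h3, h4⟩
      · rintro ⟨h3, h4⟩
        obtain rfl := hus _ _ h3
        exact ⟨p, h3, h4⟩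
  apply hends
  refine ⟨?_, ?_, ?_, ?_⟩
  · simpa using key (invRev u) v (.inr rfl) (.inl rfl)
  · simpa using key (invRev u) (invRev v) (.inr rfl) (.inr rfl)
  · simpa using key u v (.inl rfl) (.inl rfl)
  · simpa using key u (invRev v) (.inl rfl) (.inr rfl)

/-- Idempotent words that are conjugates of cyclically reduced idempotent words have a
nonempty reduced word acting as their product. -/
theorem exists_inf_conj (hinv : IsInverseAutomaton δ)
    {c d : List (A × Bool)} (hc0 : c ≠ []) (hd0 : d ≠ [])
    (hc : IsCyclicallyReduced c) (hd : IsCyclicallyReduced d)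
    (hcs : IsSubId δ c) (hds : IsSubId δ d) (s t : List (A × Bool))
    (hu : FreeGroup.IsReduced (s ++ c ++ invRev s))
    (hv : FreeGroup.IsReduced (t ++ d ++ invRev t)) :
    ∃ w : List (A × Bool), w ≠ [] ∧ FreeGroup.IsReduced w ∧
      (∀ a, a ∈ w.head? ∨ a ∈ (invRev w).head? →
        a ∈ (s ++ c ++ invRev s).head? ∨ a ∈ (invRev (s ++ c ++ invRev s)).head? ∨
        a ∈ (t ++ d ++ invRev t).head? ∨ a ∈ (invRev (t ++ d ++ invRev t)).head?) ∧
      ∀ p q, readWord δ p w = some q ↔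
        readWord δ p (s ++ c ++ invRev s) = some q ∧
        readWord δ p (t ++ d ++ invRev t) = some q := by
  have generic := exists_inf_of_ends_ne hinv (u := s ++ c ++ invRev s) (v := t ++ d ++ invRev t)
    (by simp [hc0]) (by simp [hd0]) hu hv (hcs.conj hinv s) (hds.conj hinv t)
  induction s generalizing t with
  | nil =>
    apply generic
    have := head?_ne_of_isCyclicallyReduced hc hc0
    simp only [FreeGroup.invRev_empty, List.nil_append, List.append_nil]
    rintro ⟨h1, -, h2, -⟩
    exact this (h1.trans h2.symm)
  | cons x s ih =>
    cases t with
    | nil =>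
      apply generic
      have := head?_ne_of_isCyclicallyReduced hd hd0
      simp only [FreeGroup.invRev_empty, List.nil_append, List.append_nil]
      rintro ⟨h1, h2, -, -⟩
      exact this (h1.symm.trans h2)
    | cons y t =>
      by_cases hxy : x = y
      · subst hxy
        have e : ∀ r b : List (A × Bool), x :: r ++ b ++ invRev (x :: r) =
            x :: (r ++ b ++ invRev r) ++ invRev [x] := by
          intro r b
          rw [FreeGroup.invRev_cons]
          simp
        simp only [e] at hu hv ⊢
        have hmid : ∀ r : List (A × Bool), FreeGroup.IsReduced (x :: r ++ invRev [x]) →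
            r ≠ [] → FreeGroup.IsReduced r ∧
              ∀ a, a ∈ r.head? ∨ a ∈ (invRev r).head? → a ∉ (invRev [x]).head? := by
          intro r hr hr0
          rw [isReduced_append_iff, ← List.singleton_append, isReduced_append_iff,
            FreeGroup.invRev_append, List.head?_append_of_ne_nil _ (invRev_ne_nil hr0)] at hr
          obtain ⟨⟨-, h1, h2⟩, -, h3⟩ := hr
          refine ⟨h1, ?_⟩
          rintro a (ha | ha)
          · exact fun h => h2 a h ha
          · exact h3 a ha
        have hu' := hmid _ hu (by simp [hc0])
        have hv' := hmid _ hv (by simp [hd0])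
        obtain ⟨w, hw0, hwr, hwe, hw⟩ := ih t hu'.1 hv'.1
          (exists_inf_of_ends_ne hinv (by simp [hc0]) (by simp [hd0]) hu'.1 hv'.1
            (hcs.conj hinv s) (hds.conj hinv t))
        have hwx : ∀ a, a ∈ w.head? ∨ a ∈ (invRev w).head? → a ∉ (invRev [x]).head? := by
          intro a ha
          rcases hwe a ha with h | h | h | h
          exacts [hu'.2 a (.inl h), hu'.2 a (.inr h), hv'.2 a (.inl h), hv'.2 a (.inr h)]
        refine ⟨x :: w ++ invRev [x], by simp, ?_, ?_, ?_⟩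
        · rw [isReduced_append_iff, ← List.singleton_append, isReduced_append_iff,
            FreeGroup.invRev_append, List.head?_append_of_ne_nil _ (invRev_ne_nil hw0)]
          exact ⟨⟨.singleton, hwr, fun a ha ha' => hwx a (.inl ha') ha⟩, .singleton,
            fun a ha => hwx a (.inr ha)⟩
        · have hlast : ∀ r : List (A × Bool), (invRev (x :: r ++ invRev [x])).head? = some x := by
            intro r
            simp only [FreeGroup.invRev_append, FreeGroup.invRev_invRev]
            rfl
          intro a ha
          rw [hlast] at ha
          exact .inl (ha.elim id id)
        · intro p q
          simp only [readWord_conj hinv, hw]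
          constructor
          · rintro ⟨p', q', h1, h2, h3, h4⟩
            exact ⟨⟨p', q', h1, h2, h3⟩, ⟨p', q', h1, h2, h4⟩⟩
          · rintro ⟨⟨p', q', h1, h2, h3⟩, ⟨p'', q'', h4, h5, h6⟩⟩
            rw [h1, Option.some_inj] at h4
            rw [h2, Option.some_inj] at h5
            subst h4 h5
            exact ⟨p', q', h1, h2, h3, h6⟩
      · apply generic
        simp [hxy]

/-- If the connected automaton is not complete, every nonempty path can be extended without
backtracking until it leaves the automaton. -/
theorem exists_isReduced_cons_readWord_eq_none (hinv : IsInverseAutomaton δ) [Fintype Q]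
    (hconn : ∀ p q : Q, ∃ w, readWord δ p w = some q) (hinc : ∃ r x, δ r x = none)
    {p p₀ : Q} {l : A × Bool} (hl : δ p₀ l = some p) :
    ∃ t : List (A × Bool), FreeGroup.IsReduced (l :: t) ∧ readWord δ p t = none := by
  by_contra! hD
  let P : Q → Prop := fun p => ∃ l, (∃ p₀, δ p₀ l = some p) ∧
    ∀ t : List (A × Bool), FreeGroup.IsReduced (l :: t) → readWord δ p t ≠ none
  have hstep : ∀ p, P p → ∀ x, ∃ q, δ p x = some q ∧ P q := by
    rintro p ⟨l, ⟨p₀, hl⟩, hD⟩ x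
    by_cases hx : FreeGroup.IsReduced [l, x]
    · have h1 := hD [x] hx
      rw [readWord_singleton] at h1
      obtain ⟨q, hq⟩ := Option.ne_none_iff_exists'.1 h1
      refine ⟨q, hq, x, ⟨p, hq⟩, fun t ht hn => ?_⟩
      refine hD (x :: t) (hx.append_overlap (L₁ := [l]) (L₂ := [x]) ht (by simp)) ?_
      rw [readWord_cons, hq]
      exact hn
    · have hx' := eq_of_not_isReduced_pair hx
      refine ⟨p₀, by rw [hx']; exact (hinv _ _ _ _).1 hl, ?_⟩
      have hrep : ∀ m (t : List (A × Bool)), FreeGroup.IsReduced (l :: t) →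
          FreeGroup.IsReduced (l :: (List.replicate m l ++ t)) := by
        intro m t ht
        induction m with
        | zero => exact ht
        | succ m ih =>
          rw [List.replicate_succ, List.cons_append, FreeGroup.isReduced_cons_cons]
          exact ⟨fun _ => rfl, ih⟩
      have hsub := isSubId_replicate_factorial hinv [l]
      obtain ⟨m, hm⟩ := Nat.exists_eq_succ_of_ne_zero (Nat.factorial_ne_zero (Fintype.card Q))
      rw [List.flatten_replicate_singleton, hm] at hsub
      have hread := hD _ (hrep (m + 1) [] .singleton)
      rw [List.append_nil] at hread
      obtain ⟨r, hr⟩ := Option.ne_none_iff_exists'.1 hread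
      obtain rfl := hsub _ _ hr
      rw [List.replicate_succ'] at hr
      obtain ⟨p₁, h1, h2⟩ := readWord_append_eq_some.1 hr
      obtain rfl : p₁ = p₀ := readWord_injective hinv h2 (by rwa [readWord_singleton])
      have hloop : readWord δ p₁ (List.replicate m l ++ [l]) = some p₁ := by
        rw [← List.replicate_succ', List.replicate_succ, readWord_cons, hl]
        exact h1
      obtain ⟨p₂, -, h4⟩ := readWord_append_eq_some.1 hloop
      rw [readWord_singleton] at h4
      refine ⟨l, ⟨p₂, h4⟩, fun t ht hn => hD _ (hrep m t ht) ?_⟩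
      rw [readWord_append, h1]
      exact hn
  have hread : ∀ (w : List (A × Bool)) (p q : Q), P p → readWord δ p w = some q → P q := by
    intro w
    induction w with
    | nil =>
      rintro p q hp hq
      obtain rfl : p = q := Option.some.inj hq
      exact hp
    | cons x w ih =>
      intro p q hp hq
      obtain ⟨p', hp', hP⟩ := hstep p hp x
      rw [readWord_cons, hp'] at hq
      exact ih p' q hP hq
  obtain ⟨r, x, hrx⟩ := hinc
  obtain ⟨w, hw⟩ := hconn p r
  obtain ⟨q, hq, -⟩ := hstep r (hread w p r ⟨l, ⟨p₀, hl⟩, hD⟩ hw) x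
  rw [hrx] at hq
  cases hq

/-- In a connected automaton that is not complete, every nonempty reduced word extends to a
reduced word that acts as the empty transformation. -/
theorem exists_isReduced_append_eq_none (hinv : IsInverseAutomaton δ) [Fintype Q]
    (hconn : ∀ p q : Q, ∃ w, readWord δ p w = some q) (hinc : ∃ r x, δ r x = none)
    (u : List (A × Bool)) (hu : u ≠ []) (hr : FreeGroup.IsReduced u) :
    ∃ t : List (A × Bool), FreeGroup.IsReduced (u ++ t) ∧
      ∀ q, readWord δ q (u ++ t) = none := by
  induction hn : {q | readWord δ q u ≠ none}.ncard using Nat.strong_induction_on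
    generalizing u with
  | _ n ih =>
    by_cases hall : ∀ q, readWord δ q u = none
    · exact ⟨[], by simpa using hr, by simpa using hall⟩
    · push Not at hall
      obtain ⟨q, hq⟩ := hall
      obtain ⟨p, hp⟩ := Option.ne_none_iff_exists'.1 hq
      obtain ⟨u₀, l, rfl⟩ := (List.eq_nil_or_concat' u).resolve_left hu
      obtain ⟨p₀, -, hl⟩ := readWord_append_eq_some.1 hp
      rw [readWord_singleton] at hl
      obtain ⟨t, ht, htn⟩ := exists_isReduced_cons_readWord_eq_none hinv hconn hinc hl
      have hred : FreeGroup.IsReduced (u₀ ++ [l] ++ t) := hr.append_overlap ht (by simp)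
      have hdead : readWord δ q (u₀ ++ [l] ++ t) = none := by
        rw [readWord_append, hp]
        exact htn
      have hlt : {q | readWord δ q (u₀ ++ [l] ++ t) ≠ none}.ncard < n := by
        rw [← hn]
        refine Set.ncard_lt_ncard ⟨fun r hr h => hr ?_, fun h => h hq hdead⟩ (Set.toFinite _)
        rw [readWord_append, h]
        rfl
      obtain ⟨t', ht', hn'⟩ := ih _ hlt _ (by simp) hred rfl
      exact ⟨t ++ t', by simpa using ht', by simpa using hn'⟩

theorem ptrans_mul_self_iff (hinv : IsInverseAutomaton δ) {u : List (A × Bool)} :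
    ptrans δ u * ptrans δ u = ptrans δ u ↔ IsSubId δ u := by
  constructor
  · intro h p q hq
    have h1 : ptrans δ u (ptrans δ u (some p)) = ptrans δ u (some p) := congrFun h (some p)
    have h2 : ptrans δ u (some p) = some q := hq
    rw [h2] at h1
    exact readWord_injective hinv hq h1
  · intro h
    funext o
    rcases o with _ | p
    · rfl
    · change ptrans δ u (readWord δ p u) = readWord δ p u
      rcases hp : readWord δ p u with _ | q
      · rfl
      · obtain rfl := h _ _ hp
        exact hp

theorem mem_idemSet_iff (hinv : IsInverseAutomaton δ)
    [DecidableEq A] {m : Function.End (Option Q)} :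
    m ∈ idemSet δ ↔ ∃ u : List (A × Bool), u ≠ [] ∧ FreeGroup.IsReduced u ∧ IsSubId δ u ∧
      m = ptrans δ u := by
  unfold idemSet
  simp only [Set.mem_ofPred_eq, ← FreeGroup.isReduced_iff_reduce_eq]
  constructor
  · rintro ⟨u, h1, h2, rfl, h3⟩
    exact ⟨u, h1, h2, (ptrans_mul_self_iff hinv).1 h3, rfl⟩
  · rintro ⟨u, h1, h2, h3, rfl⟩
    exact ⟨u, h1, h2, rfl, (ptrans_mul_self_iff hinv).2 h3⟩

theorem IsSubId.ptrans_ext {u v : List (A × Bool)} (hu : IsSubId δ u) (hv : IsSubId δ v)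
    (h : ∀ p, readWord δ p u = some p ↔ readWord δ p v = some p) : ptrans δ u = ptrans δ v := by
  funext o
  rcases o with _ | p
  · rfl
  · change readWord δ p u = readWord δ p v
    ext q
    constructor
    · intro hq
      obtain rfl := hu _ _ hq
      exact (h _).1 hq
    · intro hq
      obtain rfl := hv _ _ hq
      exact (h _).2 hq

theorem IsSubId.ptrans_mul_eq_left {u v : List (A × Bool)} (hu : IsSubId δ u) (hv : IsSubId δ v)
    (h : ∀ p, readWord δ p u = some p → readWord δ p v = some p) :
    ptrans δ u * ptrans δ v = ptrans δ u := by
  funext o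
  rcases o with _ | p
  · rfl
  · change ptrans δ u (readWord δ p v) = readWord δ p u
    rcases hp : readWord δ p v with _ | q
    · rcases hq : readWord δ p u with _ | r
      · rfl
      · obtain rfl := hu _ _ hq
        rw [h _ hq] at hp
        cases hp
    · obtain rfl := hv _ _ hp
      rfl

/-- A word loses no loops when `δ_u` lies below `δ_v`. -/
theorem IsSubId.readWord_of_ptrans_mul {u v : List (A × Bool)} (hv : IsSubId δ v)
    (h : ptrans δ u * ptrans δ v = ptrans δ u) {p : Q} (hp : readWord δ p u = some p) :
    readWord δ p v = some p := by
  have h1 : ptrans δ u (readWord δ p v) = readWord δ p u := congrFun h (some p)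
  rw [hp] at h1
  rcases hq : readWord δ p v with _ | q
  · rw [hq] at h1
    cases h1
  · obtain rfl := hv _ _ hq
    rfl

theorem IsSubId.of_eq_none {z : List (A × Bool)} (hz : ∀ q, readWord δ q z = none) :
    IsSubId δ z := by
  intro p q h
  rw [hz] at h
  cases h

/-- If idempotents sharing a fixed point coincide, the idempotents are parametrised by the
fixed points, together with the empty transformation. -/
theorem idemSet_eq_range (hinv : IsInverseAutomaton δ)
    [DecidableEq A] {z : List (A × Bool)} (hz0 : z ≠ [])
    (hzr : FreeGroup.IsReduced z) (hz : ∀ q, readWord δ q z = none)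
    {U : Q → List (A × Bool)} (hU0 : ∀ q, U q ≠ []) (hUr : ∀ q, FreeGroup.IsReduced (U q))
    (hUs : ∀ q, IsSubId δ (U q)) (hU : ∀ q, readWord δ q (U q) = some q)
    (huniq : ∀ (u v : List (A × Bool)) (p : Q), u ≠ [] → v ≠ [] → FreeGroup.IsReduced u →
      FreeGroup.IsReduced v → IsSubId δ u → IsSubId δ v → readWord δ p u = some p →
      readWord δ p v = some p → ptrans δ u = ptrans δ v) :
    idemSet δ = Set.range fun o : Option Q => ptrans δ (o.elim z U) := by
  ext m
  rw [mem_idemSet_iff hinv]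
  constructor
  · rintro ⟨u, hu0, hur, hus, rfl⟩
    by_cases h : ∃ p, readWord δ p u = some p
    · obtain ⟨p, hp⟩ := h
      exact ⟨some p, huniq _ _ p (hU0 p) hu0 (hUr p) hur (hUs p) hus (hU p) hp⟩
    · push Not at h
      refine ⟨none, IsSubId.ptrans_ext (.of_eq_none hz) hus fun p => ?_⟩
      simp [hz, h]
  · rintro ⟨_ | q, rfl⟩
    · exact ⟨z, hz0, hzr, .of_eq_none hz, rfl⟩
    · exact ⟨U q, hU0 q, hUr q, hUs q, rfl⟩

section Link

variable [DecidableEq A] {K : Subgroup (FreeGroup A)} {q₀ : Q}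

theorem eq_of_readWord_of_mk_eq (hinv : IsInverseAutomaton δ) {p q q' : Q} {u v : List (A × Bool)}
    (h : FreeGroup.mk u = FreeGroup.mk v) (hu : readWord δ p u = some q)
    (hv : readWord δ p v = some q') : q = q' := by
  have h1 := readWord_of_red hinv FreeGroup.reduce.red hu
  have h2 := readWord_of_red hinv FreeGroup.reduce.red hv
  rw [FreeGroup.reduce.sound h, h2] at h1
  exact (Option.some.inj h1).symm

/-- The reduced words accepted at `q₀` are those representing elements of `K`. -/
def Recognizes (δ : Q → A × Bool → Option Q) (q₀ : Q) (K : Subgroup (FreeGroup A)) : Prop :=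
  ∀ w : List (A × Bool), FreeGroup.reduce w = w →
    (FreeGroup.mk w ∈ K ↔ readWord δ q₀ w = some q₀)

theorem mk_mem_iff (hlink : Recognizes δ q₀ K) {w : List (A × Bool)} :
    FreeGroup.mk w ∈ K ↔ readWord δ q₀ (FreeGroup.reduce w) = some q₀ := by
  rw [← hlink _ FreeGroup.reduce.idem, FreeGroup.reduce.self]

theorem mk_mem_of_loop (hinv : IsInverseAutomaton δ) (hlink : Recognizes δ q₀ K)
    {w : List (A × Bool)} (h : readWord δ q₀ w = some q₀) :
    FreeGroup.mk w ∈ K :=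
  (mk_mem_iff hlink).2 (readWord_of_red hinv FreeGroup.reduce.red h)

theorem mk_conj_mem_of_loop (hinv : IsInverseAutomaton δ) (hlink : Recognizes δ q₀ K)
    {p : Q} {s u : List (A × Bool)} (hs : readWord δ q₀ s = some p)
    (hu : readWord δ p u = some p) :
    FreeGroup.mk s * FreeGroup.mk u * (FreeGroup.mk s)⁻¹ ∈ K := by
  rw [FreeGroup.inv_mk, FreeGroup.mul_mk, FreeGroup.mul_mk]
  refine mk_mem_of_loop hinv hlink (readWord_append_eq_some.2 ⟨p, ?_, ?_⟩)
  · exact readWord_append_eq_some.2 ⟨p, hs, hu⟩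
  · exact (readWord_invRev hinv).2 hs

theorem eq_of_mk_mul_inv_mem (hinv : IsInverseAutomaton δ) (hlink : Recognizes δ q₀ K)
    {p q : Q} {s t : List (A × Bool)} (hs : readWord δ q₀ s = some p)
    (ht : readWord δ q₀ t = some q)
    (h : FreeGroup.mk s * (FreeGroup.mk t)⁻¹ ∈ K) : p = q := by
  rw [FreeGroup.inv_mk, FreeGroup.mul_mk, mk_mem_iff hlink] at h
  refine eq_of_readWord_of_mk_eq hinv ?_ hs (readWord_append_eq_some.2 ⟨q₀, h, ht⟩)
  rw [← FreeGroup.mul_mk, FreeGroup.reduce.self, ← FreeGroup.mul_mk, ← FreeGroup.inv_mk,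
    inv_mul_cancel_right]

theorem eq_of_loop_of_malnormal (hinv : IsInverseAutomaton δ) (hlink : Recognizes δ q₀ K)
    (hconn : ∀ q : Q, ∃ w, readWord δ q₀ w = some q)
    (hmal : ∀ g : FreeGroup A, g ∉ K → ∀ x : FreeGroup A, x ∈ K → g⁻¹ * x * g ∈ K → x = 1)
    {u : List (A × Bool)} (hu : u ≠ []) (hr : FreeGroup.IsReduced u) {p q : Q}
    (hp : readWord δ p u = some p) (hq : readWord δ q u = some q) : p = q := by
  obtain ⟨s, hs⟩ := hconn p
  obtain ⟨t, ht⟩ := hconn q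
  by_contra hpq
  have hx := hmal _ (fun h => hpq (eq_of_mk_mul_inv_mem hinv hlink hs ht h)) _
    (mk_conj_mem_of_loop hinv hlink hs hp) (by
      convert mk_conj_mem_of_loop hinv hlink ht hq using 1
      group)
  rw [conj_eq_one_iff, ← FreeGroup.toWord_eq_nil_iff, FreeGroup.toWord_mk, hr.reduce_eq] at hx
  exact hu hx

/-- If the group is nontrivial, every state carries a loop labelled by a nonempty reduced word. -/
theorem exists_loop (hinv : IsInverseAutomaton δ) (hlink : Recognizes δ q₀ K)
    (hconn : ∀ q : Q, ∃ w, readWord δ q₀ w = some q) (hK : K ≠ ⊥) (p : Q) :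
    ∃ u : List (A × Bool), u ≠ [] ∧ FreeGroup.IsReduced u ∧ readWord δ p u = some p := by
  obtain ⟨⟨x, hx⟩, hx1⟩ := Subgroup.ne_bot_iff_exists_ne_one.1 hK
  replace hx1 : x ≠ 1 := fun h => hx1 (Subtype.ext h)
  obtain ⟨s, hs⟩ := hconn p
  have hxr := (hlink _ (FreeGroup.reduce_toWord x)).1 (by rwa [FreeGroup.mk_toWord])
  refine ⟨FreeGroup.reduce (invRev s ++ x.toWord ++ s), fun h => hx1 ?_, ?_, ?_⟩
  · rw [← FreeGroup.toWord_mk, FreeGroup.toWord_eq_nil_iff, ← FreeGroup.mul_mk,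
      ← FreeGroup.mul_mk, FreeGroup.mk_toWord, ← FreeGroup.inv_mk] at h
    rwa [mul_eq_one_iff_eq_inv, mul_eq_left] at h
  · rw [FreeGroup.isReduced_iff_reduce_eq]
    exact FreeGroup.reduce.idem
  · refine readWord_of_red hinv FreeGroup.reduce.red (readWord_append_eq_some.2 ⟨q₀, ?_, hs⟩)
    exact readWord_append_eq_some.2 ⟨q₀, (readWord_invRev hinv).2 hs, hxr⟩

theorem exists_isSubId_loop (hinv : IsInverseAutomaton δ) (hlink : Recognizes δ q₀ K)
    [Fintype Q] (hconn : ∀ q : Q, ∃ w, readWord δ q₀ w = some q)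
    (hK : K ≠ ⊥) (p : Q) :
    ∃ u : List (A × Bool), u ≠ [] ∧ FreeGroup.IsReduced u ∧ IsSubId δ u ∧
      readWord δ p u = some p := by
  obtain ⟨u, hu, hur, hup⟩ := exists_loop hinv hlink hconn hK p
  obtain ⟨s, c, hc0, -, hcs, hr, h⟩ := exists_isSubId_conj hinv hu hur
  exact ⟨_, by simp [hc0], hr, hcs.conj hinv s, h p hup⟩

/-- A nontrivial intersection of the group with a proper conjugate yields a nonempty reduced word
labelling loops at two distinct states. -/
theorem exists_two_loops (hinv : IsInverseAutomaton δ) (hlink : Recognizes δ q₀ K)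
    [Fintype Q] {g x : FreeGroup A} (hg : g ∉ K) (hx : x ∈ K)
    (hgx : g⁻¹ * x * g ∈ K) (hx1 : x ≠ 1) :
    ∃ (u : List (A × Bool)) (p q : Q), u ≠ [] ∧ FreeGroup.IsReduced u ∧ p ≠ q ∧
      readWord δ p u = some p ∧ readWord δ q u = some q := by
  have hX := (hlink _ (FreeGroup.reduce_toWord x)).1 (by rwa [FreeGroup.mk_toWord])
  obtain ⟨s, c, hc0, hc, hsc⟩ := exists_eq_conj_isCyclicallyReduced
    (mt FreeGroup.toWord_eq_nil_iff.1 hx1) (FreeGroup.isReduced_toWord (x := x))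
  have hxe : x = FreeGroup.mk s * FreeGroup.mk c * (FreeGroup.mk s)⁻¹ := by
    rw [FreeGroup.inv_mk, FreeGroup.mul_mk, FreeGroup.mul_mk, hsc, FreeGroup.mk_toWord]
  rw [← hsc, readWord_append_eq_some] at hX
  obtain ⟨p', hX, hs'⟩ := hX
  obtain ⟨p, hs, hcp⟩ := readWord_append_eq_some.1 hX
  obtain rfl : p = p' := Option.some.inj (hs.symm.trans ((readWord_invRev hinv).1 hs'))
  obtain ⟨N, w, -, hwr, hwl, hwe⟩ := exists_isReduced_mul_pow hc hc0 (g⁻¹.toWord ++ s)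
  obtain ⟨N', w', -, hwr', hwl', hwe'⟩ := exists_isReduced_mul_pow (isCyclicallyReduced_invRev hc)
    (invRev_ne_nil hc0) (g⁻¹.toWord ++ s)
  rw [← FreeGroup.mul_mk, FreeGroup.mk_toWord] at hwe hwe'
  rw [← FreeGroup.inv_mk] at hwe'
  have hcc := (isReduced_append_iff.1 (isReduced_append_self hc)).2.2
  have hred : FreeGroup.IsReduced (w ++ c ++ invRev w') := by
    refine FreeGroup.IsReduced.append_overlap ?_ ?_ hc0
    · rw [isReduced_append_iff, head?_invRev, hwl, ← head?_invRev]
      exact ⟨hwr, hc.isReduced, hcc⟩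
    · rw [isReduced_append_iff, head?_invRev w', hwl', ← head?_invRev, FreeGroup.invRev_invRev]
      exact ⟨hc.isReduced, isReduced_invRev hwr', hcc⟩
  set M := (Fintype.card Q).factorial with hMdef
  have hM : M ≠ 0 := Nat.factorial_ne_zero _
  have hW := FreeGroup.IsReduced.append_flatten_replicate_append hc hred hM
  have hmkpow : ∀ n, FreeGroup.mk (List.replicate n c).flatten = FreeGroup.mk c ^ n :=
    fun n => (FreeGroup.pow_mk n).symm
  have hWK := (hlink _ hW.reduce_eq).1 (by
    rw [← FreeGroup.mul_mk, ← FreeGroup.mul_mk, ← FreeGroup.inv_mk, hwe, hwe', hmkpow]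
    convert K.pow_mem hgx (N + M + N') using 1
    have : g⁻¹ * x * g = (g⁻¹ * FreeGroup.mk s) * FreeGroup.mk c * (g⁻¹ * FreeGroup.mk s)⁻¹ := by
      rw [hxe]
      group
    rw [this, conj_pow]
    group)
  obtain ⟨_, hWK, -⟩ := readWord_append_eq_some.1 hWK
  obtain ⟨r, hwr0, hcr⟩ := readWord_append_eq_some.1 hWK
  obtain rfl := isSubId_replicate_factorial hinv c _ _ hcr
  refine ⟨_, p, r, ?_, (hc.flatten_replicate M).isReduced, ?_, readWord_replicate_of_loop hcp M,
    hcr⟩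
  · obtain ⟨m, hm⟩ := Nat.exists_eq_succ_of_ne_zero hM
    simp [hm, List.replicate_succ, hc0]
  · rintro rfl
    have h := mk_mem_of_loop hinv hlink (readWord_append_eq_some.2
      ⟨p, hwr0, (readWord_invRev hinv).2 hs⟩)
    rw [← FreeGroup.mul_mk, hwe, ← FreeGroup.inv_mk, mul_assoc, mul_assoc,
      ← mul_assoc (FreeGroup.mk s), ← conj_pow, ← hxe, K.mul_mem_cancel_right (K.pow_mem hx N)] at h
    exact hg (K.inv_mem_iff.1 h)

end Link

end Automaton

/-- Let `1 ≠ K < F_A` be f.g. with Stallings automaton `(Q, δ, q₀)`, `E`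
the set of idempotents among the `δ_u` for `u` a nonempty reduced word, ordered by the
natural partial order (`e ≤ f` iff `e * f = e`), and `k` the size of a maximal chain in
`E`. Then `K` is malnormal iff `k = 2` (there is a 2-chain but no 3-chain) and
`|E| = |Q| + 1`. -/
theorem stmt_15 {A Q : Type} [DecidableEq A] [Fintype Q]
    (K : Subgroup (FreeGroup A)) (δ : Q → A × Bool → Option Q) (q₀ : Q)
    (hinv : ∀ (p q : Q) (a : A) (b : Bool), δ p (a, b) = some q ↔ δ q (a, !b) = some p)
    (hconn : ∀ q : Q, ∃ w : List (A × Bool), readWord δ q₀ w = some q)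
    (hdeg : ∀ q : Q, q ≠ q₀ → 2 ≤ {x : A × Bool | (δ q x).isSome}.ncard)
    (hlink : ∀ w : List (A × Bool), FreeGroup.reduce w = w →
      (FreeGroup.mk w ∈ K ↔ readWord δ q₀ w = some q₀))
    (hKbot : K ≠ ⊥) (hKtop : K ≠ ⊤) :
    -- K is malnormal
    (∀ g : FreeGroup A, g ∉ K → ∀ x : FreeGroup A, x ∈ K → g⁻¹ * x * g ∈ K → x = 1) ↔
      ((∃ e ∈ idemSet δ, ∃ f ∈ idemSet δ, e * f = e ∧ e ≠ f) ∧
        (¬ ∃ e ∈ idemSet δ, ∃ f ∈ idemSet δ, ∃ g ∈ idemSet δ,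
          e * f = e ∧ e ≠ f ∧ f * g = f ∧ f ≠ g) ∧
        (idemSet δ).ncard = Fintype.card Q + 1) := by
  have hconn' : ∀ p q : Q, ∃ w, readWord δ p w = some q := by
    intro p q
    obtain ⟨s, hs⟩ := hconn p
    obtain ⟨t, ht⟩ := hconn q
    exact ⟨FreeGroup.invRev s ++ t,
      readWord_append_eq_some.2 ⟨q₀, (readWord_invRev hinv).2 hs, ht⟩⟩
  choose U hU0 hUr hUs hU using exists_isSubId_loop hinv hlink hconn hKbot
  have hUmem : ∀ q, ptrans δ (U q) ∈ idemSet δ := fun q =>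
    (mem_idemSet_iff hinv).2 ⟨U q, hU0 q, hUr q, hUs q, rfl⟩
  have hdead : (∃ r x, δ r x = none) → ∃ z : List (A × Bool), z ≠ [] ∧
      FreeGroup.IsReduced z ∧ ∀ q, readWord δ q z = none := by
    intro hinc
    obtain ⟨t, ht, htn⟩ := exists_isReduced_append_eq_none hinv hconn' hinc _ (hU0 q₀) (hUr q₀)
    exact ⟨_, by simp [hU0], ht, htn⟩
  have hne : ∀ {z : List (A × Bool)}, (∀ q, readWord δ q z = none) → ∀ q,
      ptrans δ z ≠ ptrans δ (U q) := by
    intro z hz q h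
    have h1 : readWord δ q z = readWord δ q (U q) := congrFun h (some q)
    rw [hz, hU] at h1
    cases h1
  have hcomplete : (¬ ∃ r x, δ r x = none) → ∀ (w : List (A × Bool)) (p : Q),
      ∃ q, readWord δ p w = some q := by
    intro h w
    push Not at h
    induction w with
    | nil => exact fun p => ⟨p, rfl⟩
    | cons x w ih =>
      intro p
      obtain ⟨q, hq⟩ := Option.ne_none_iff_exists'.1 (h p x)
      rw [readWord_cons, hq]
      exact ih q
  constructor
  · intro hmal
    have hloop : ∀ (u : List (A × Bool)) (p q : Q), u ≠ [] → FreeGroup.IsReduced u →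
        readWord δ p u = some p → readWord δ q u = some q → p = q :=
      fun u p q hu hr => eq_of_loop_of_malnormal hinv hlink hconn hmal hu hr
    have huniq : ∀ (u v : List (A × Bool)) (p : Q), u ≠ [] → v ≠ [] → FreeGroup.IsReduced u →
        FreeGroup.IsReduced v → IsSubId δ u → IsSubId δ v → readWord δ p u = some p →
        readWord δ p v = some p → ptrans δ u = ptrans δ v := by
      intro u v p hu hv hur hvr hus hvs hpu hpv
      refine hus.ptrans_ext hvs fun q => ⟨fun hq => ?_, fun hq => ?_⟩
      · rwa [hloop u q p hu hur hq hpu]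
      · rwa [hloop v q p hv hvr hq hpv]
    have hinc : ∃ r x, δ r x = none := by
      by_contra h
      apply hKtop
      have hall : ∀ q, q = q₀ := by
        intro q
        obtain ⟨r, hr⟩ := hcomplete h (U q₀) q
        obtain rfl := hUs q₀ _ _ hr
        exact hloop _ _ _ (hU0 q₀) (hUr q₀) hr (hU q₀)
      refine (Subgroup.eq_top_iff' K).2 fun x => ?_
      obtain ⟨r, hr⟩ := hcomplete h x.toWord q₀
      rw [← FreeGroup.mk_toWord (x := x)]
      refine mk_mem_of_loop hinv hlink ?_
      rwa [hall r] at hr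
    obtain ⟨z, hz0, hzr, hz⟩ := hdead hinc
    refine ⟨⟨ptrans δ z, (mem_idemSet_iff hinv).2 ⟨z, hz0, hzr, .of_eq_none hz, rfl⟩,
      ptrans δ (U q₀), hUmem q₀, ?_, hne hz q₀⟩, ?_, ?_⟩
    · exact (IsSubId.of_eq_none hz).ptrans_mul_eq_left (hUs q₀) fun p hp => by
        rw [hz] at hp
        cases hp
    · rintro ⟨e, he, f, hf, g, hg, hef, hef', hfg, hfg'⟩
      obtain ⟨u, -, -, hus, rfl⟩ := (mem_idemSet_iff hinv).1 he
      obtain ⟨v, hv0, hvr, hvs, rfl⟩ := (mem_idemSet_iff hinv).1 hf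
      obtain ⟨w, hw0, hwr, hws, rfl⟩ := (mem_idemSet_iff hinv).1 hg
      by_cases h : ∃ p, readWord δ p v = some p
      · obtain ⟨p, hp⟩ := h
        exact hfg' (huniq v w p hv0 hw0 hvr hwr hvs hws hp (hws.readWord_of_ptrans_mul hfg hp))
      · push Not at h
        refine hef' (hus.ptrans_ext hvs fun p => ⟨hvs.readWord_of_ptrans_mul hef, fun hp => ?_⟩)
        exact absurd hp (h p)
    · rw [idemSet_eq_range hinv hz0 hzr hz hU0 hUr hUs hU huniq, ← Set.image_univ,
        Set.ncard_image_of_injective, Set.ncard_univ, Nat.card_eq_fintype_card,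
        Fintype.card_option]
      rintro (_ | p) (_ | q) h
      · rfl
      · exact absurd h (hne hz q)
      · exact absurd h.symm (hne hz p)
      · have h1 : readWord δ p (U p) = readWord δ p (U q) := congrFun h (some p)
        rw [hU] at h1
        rw [hloop _ _ _ (hU0 q) (hUr q) h1.symm (hU q)]
  · rintro ⟨⟨e, he, f, hf, hef, hef'⟩, hchain, hcard⟩
    have hinc : ∃ r x, δ r x = none := by
      by_contra h
      obtain ⟨u, -, -, hus, rfl⟩ := (mem_idemSet_iff hinv).1 he
      obtain ⟨v, -, -, hvs, rfl⟩ := (mem_idemSet_iff hinv).1 hf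
      have hid : ∀ w : List (A × Bool), IsSubId δ w → ∀ p, readWord δ p w = some p := by
        intro w hw p
        obtain ⟨q, hq⟩ := hcomplete h w p
        obtain rfl := hw _ _ hq
        exact hq
      exact hef' (hus.ptrans_ext hvs fun p => iff_of_true (hid u hus p) (hid v hvs p))
    obtain ⟨z, hz0, hzr, hz⟩ := hdead hinc
    have hmin : ∀ (u v : List (A × Bool)) (p : Q), u ≠ [] → v ≠ [] → FreeGroup.IsReduced u →
        FreeGroup.IsReduced v → IsSubId δ u → IsSubId δ v → readWord δ p u = some p →
        (∀ q, readWord δ q u = some q → readWord δ q v = some q) → ptrans δ u = ptrans δ v := by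
      intro u v p hu hv hur hvr hus hvs hp huv
      by_contra hne'
      refine hchain ⟨ptrans δ z, (mem_idemSet_iff hinv).2 ⟨z, hz0, hzr, .of_eq_none hz, rfl⟩,
        ptrans δ u, (mem_idemSet_iff hinv).2 ⟨u, hu, hur, hus, rfl⟩,
        ptrans δ v, (mem_idemSet_iff hinv).2 ⟨v, hv, hvr, hvs, rfl⟩, ?_, ?_,
        hus.ptrans_mul_eq_left hvs huv, hne'⟩
      · exact (IsSubId.of_eq_none hz).ptrans_mul_eq_left hus fun p hp => by
          rw [hz] at hp
          cases hp
      · intro h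
        have h1 : readWord δ p z = readWord δ p u := congrFun h (some p)
        rw [hz, hp] at h1
        cases h1
    have huniq : ∀ (u v : List (A × Bool)) (p : Q), u ≠ [] → v ≠ [] → FreeGroup.IsReduced u →
        FreeGroup.IsReduced v → IsSubId δ u → IsSubId δ v → readWord δ p u = some p →
        readWord δ p v = some p → ptrans δ u = ptrans δ v := by
      intro u v p hu hv hur hvr hus hvs hpu hpv
      obtain ⟨s, c, hc0, hc, hcs, hr, hsub⟩ := exists_isSubId_conj hinv hu hur
      obtain ⟨t, d, hd0, hd, hds, hr', hsub'⟩ := exists_isSubId_conj hinv hv hvr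
      obtain ⟨w, hw0, hwr, -, hw⟩ := exists_inf_conj hinv hc0 hd0 hc hd hcs hds s t hr hr'
      have hws : IsSubId δ w := fun a b h => hcs.conj hinv s a b ((hw a b).1 h).1
      have hwp : readWord δ p w = some p := (hw p p).2 ⟨hsub p hpu, hsub' p hpv⟩
      rw [hmin u _ p hu (by simp [hc0]) hur hr hus (hcs.conj hinv s) hpu hsub,
        hmin v _ p hv (by simp [hd0]) hvr hr' hvs (hds.conj hinv t) hpv hsub',
        ← hmin w _ p hw0 (by simp [hc0]) hwr hr hws (hcs.conj hinv s) hwp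
          fun q hq => ((hw q q).1 hq).1,
        ← hmin w _ p hw0 (by simp [hd0]) hwr hr' hws (hds.conj hinv t) hwp
          fun q hq => ((hw q q).1 hq).2]
    have hinj : Set.InjOn (fun o : Option Q => ptrans δ (o.elim z U)) Set.univ := by
      rw [← Set.ncard_image_iff, Set.image_univ,
        ← idemSet_eq_range hinv hz0 hzr hz hU0 hUr hUs hU huniq, hcard, Set.ncard_univ,
        Nat.card_eq_fintype_card, Fintype.card_option]
    intro g hg x hx hgx
    by_contra hx1
    obtain ⟨u, p, q, hu0, hur, hpq, hp, hq⟩ := exists_two_loops hinv hlink hg hx hgx hx1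
    obtain ⟨s, c, hc0, -, hcs, hr, hsub⟩ := exists_isSubId_conj hinv hu0 hur
    have hfix : ∀ a, readWord δ a u = some a →
        ptrans δ (U a) = ptrans δ (s ++ c ++ FreeGroup.invRev s) := fun a ha =>
      huniq _ _ a (hU0 a) (by simp [hc0]) (hUr a) hr (hUs a) (hcs.conj hinv s) (hU a) (hsub a ha)
    exact hpq (Option.some.inj
      (hinj (Set.mem_univ (some p)) (Set.mem_univ (some q)) ((hfix p hp).trans (hfix q hq).symm)))
end

section
/- Let F_A be the free group over a finite alphabet A with |A| ≥ 2. Then the automorphisms α_a (sending a ↦ a⁻¹ and fixing all other generators) and β_{ab} (sending a ↦ ab and fixing all other generators), for distinct a, b ∈ A, generate Aut(F_A) as a group. -/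
namespace FreeGroup

section Norm

variable {α : Type*} [DecidableEq α]

theorem IsReduced.invRev {L : List (α × Bool)} (h : IsReduced L) :
    IsReduced (FreeGroup.invRev L) := by
  rw [isReduced_iff_reduce_eq, reduce_invRev, h.reduce_eq]

theorem IsReduced.exists_common_prefix {L₁ L₂ : List (α × Bool)} (h₁ : IsReduced L₁)
    (h₂ : IsReduced L₂) : ∃ P M₁ M₂, L₁ = P ++ M₁ ∧ L₂ = P ++ M₂ ∧
      IsReduced (FreeGroup.invRev M₁ ++ M₂) := by
  induction L₁ generalizing L₂ with
  | nil => exact ⟨[], [], L₂, by simpa using h₂⟩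
  | cons a L₁ ih =>
    cases L₂ with
    | nil => exact ⟨[], a :: L₁, [], by simpa using h₁.invRev⟩
    | cons b L₂ =>
      by_cases hab : a = b
      · subst hab
        obtain ⟨P, M₁, M₂, rfl, rfl, h⟩ := ih (h₁.infix (List.suffix_cons a L₁).isInfix)
          (h₂.infix (List.suffix_cons a L₂).isInfix)
        exact ⟨a :: P, M₁, M₂, rfl, rfl, h⟩
      · refine ⟨[], a :: L₁, b :: L₂, rfl, rfl, ?_⟩
        have h := h₁.invRev
        rw [invRev_cons] at h ⊢
        refine h.append_overlap ?_ (by simp [FreeGroup.invRev])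
        obtain ⟨a, i⟩ := a
        obtain ⟨b, j⟩ := b
        simp only [FreeGroup.invRev, List.map_cons, List.map_nil, List.reverse_singleton,
          List.singleton_append, isReduced_cons_cons]
        refine ⟨?_, h₂⟩
        rintro rfl
        revert hab
        cases i <;> cases j <;> simp

/-- The reduced words of `x` and `y` agree on their first `n` letters. -/
def CommonPrefix (n : ℕ) (x y : FreeGroup α) : Prop :=
  n ≤ norm x ∧ n ≤ norm y ∧ x.toWord.take n = y.toWord.take n

theorem CommonPrefix.symm {n : ℕ} {x y : FreeGroup α} (h : CommonPrefix n x y) :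
    CommonPrefix n y x :=
  ⟨h.2.1, h.1, h.2.2.symm⟩

theorem CommonPrefix.trans {n : ℕ} {x y z : FreeGroup α} (h : CommonPrefix n x y)
    (h' : CommonPrefix n y z) : CommonPrefix n x z :=
  ⟨h.1, h'.2.1, h.2.2.trans h'.2.2⟩

theorem CommonPrefix.mono {m n : ℕ} {x y : FreeGroup α} (h : CommonPrefix n x y) (hmn : m ≤ n) :
    CommonPrefix m x y := by
  refine ⟨hmn.trans h.1, hmn.trans h.2.1, ?_⟩
  simpa [List.take_take, hmn] using congrArg (List.take m) h.2.2

theorem inv_mul_eq_mk {n : ℕ} {x y : FreeGroup α} (h : x.toWord.take n = y.toWord.take n) :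
    x⁻¹ * y = mk (invRev (x.toWord.drop n) ++ y.toWord.drop n) := by
  have hx : x = mk (x.toWord.take n) * mk (x.toWord.drop n) := by simp [mk_toWord]
  have hy : y = mk (y.toWord.take n) * mk (y.toWord.drop n) := by simp [mk_toWord]
  rw [← mul_mk, ← inv_mk]
  conv_lhs => rw [hx, hy, h]
  group

theorem exists_commonPrefix_norm_inv_mul (x y : FreeGroup α) :
    ∃ n, CommonPrefix n x y ∧ norm (x⁻¹ * y) + 2 * n = norm x + norm y := by
  obtain ⟨P, M₁, M₂, hx, hy, h⟩ :=
    (isReduced_toWord (x := x)).exists_common_prefix (isReduced_toWord (x := y))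
  have hxy : x.toWord.take P.length = y.toWord.take P.length := by simp [hx, hy]
  refine ⟨P.length, ⟨by simp [norm, hx], by simp [norm, hy], hxy⟩, ?_⟩
  rw [inv_mul_eq_mk hxy]
  simp only [norm, toWord_mk, hx, hy, List.drop_left, h.reduce_eq, List.length_append,
    invRev_length]
  ring

theorem commonPrefix_iff {n : ℕ} {x y : FreeGroup α} :
    CommonPrefix n x y ↔ norm (x⁻¹ * y) + 2 * n ≤ norm x + norm y := by
  constructor
  · rintro ⟨hx, hy, h⟩
    have := norm_mk_le (L₁ := invRev (x.toWord.drop n) ++ y.toWord.drop n)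
    rw [← inv_mul_eq_mk h] at this
    simp only [List.length_append, invRev_length, List.length_drop] at this
    simp only [norm] at *
    omega
  · intro h
    obtain ⟨m, hm, h'⟩ := exists_commonPrefix_norm_inv_mul x y
    exact hm.mono (by omega)

theorem norm_mul_add_norm_of_lt {x y z : FreeGroup α}
    (h : norm x + norm (y⁻¹ * z) < norm (x * y) + norm z) :
    norm (x * z) + norm y = norm (x * y) + norm z := by
  obtain ⟨n, hn, hn'⟩ := exists_commonPrefix_norm_inv_mul x⁻¹ y
  obtain ⟨k, hk, hk'⟩ := exists_commonPrefix_norm_inv_mul y z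
  obtain ⟨m, hm, hm'⟩ := exists_commonPrefix_norm_inv_mul x⁻¹ z
  simp only [inv_inv, norm_inv_eq] at hn' hm'
  have hnk : n < k := by omega
  have h₁ : n ≤ m := by
    have := commonPrefix_iff.1 (hn.trans (hk.mono hnk.le))
    simp only [inv_inv, norm_inv_eq] at this
    omega
  have h₂ : m ≤ n := by
    by_contra! hlt
    have := commonPrefix_iff.1 ((hm.mono hlt).trans (hk.mono hnk).symm)
    simp only [inv_inv, norm_inv_eq] at this
    omega
  omega

theorem exists_norm_mul_add (x y : FreeGroup α) : ∃ n, norm (x * y) + 2 * n = norm x + norm y := by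
  obtain ⟨n, -, h⟩ := exists_commonPrefix_norm_inv_mul x⁻¹ y
  exact ⟨n, by simpa using h⟩

theorem norm_lt_norm_mul_self {x : FreeGroup α} (hx : x ≠ 1) : norm x < norm (x * x) := by
  have h := isReduced_toWord (x := x)
  have h₁ := reduceCyclically.reduce_flatten_replicate_succ h 0
  have h₂ := reduceCyclically.reduce_flatten_replicate_succ h 1
  simp only [List.replicate, List.flatten_cons, List.flatten_nil, List.append_nil,
    h.reduce_eq] at h₁ h₂
  have hne : reduceCyclically x.toWord ≠ [] := by
    intro h0
    apply hx
    rw [← mk_toWord (x := x), h₁, h0, List.append_nil, ← mul_mk, ← inv_mk, mul_inv_cancel]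
  have := List.length_pos_iff.2 hne
  rw [norm, norm, toWord_mul, h₂]
  conv_lhs => rw [h₁]
  simp only [List.length_append]
  omega

theorem toWord_mk_of_length_le {L : List (α × Bool)} (h : L.length ≤ norm (mk L)) :
    (mk L).toWord = L := by
  rw [toWord_mk]
  exact (reduce.red (L := L)).sublist.eq_of_length_le (by simpa [norm] using h)

end Norm

section WordValue

variable {α : Type*} [Fintype α]

/-- A numerical encoding of words, which orders the words of a given length lexicographically. -/
noncomputable def wordValue (L : List (α × Bool)) : ℕ :=
  Nat.ofDigits (Fintype.card (α × Bool) + 2)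
    (L.reverse.map fun s ↦ (Fintype.equivFin (α × Bool) s : ℕ))

theorem wordValue_append (L M : List (α × Bool)) :
    wordValue (L ++ M) =
      wordValue M + (Fintype.card (α × Bool) + 2) ^ M.length * wordValue L := by
  simp [wordValue, Nat.ofDigits_append]

theorem wordValue_injOn_length {L M : List (α × Bool)} (hlen : L.length = M.length)
    (h : wordValue L = wordValue M) : L = M := by
  have := Nat.ofDigits_inj_of_len_eq (by omega) (by simpa using hlen) ?_ ?_ h
  · refine List.reverse_injective ((List.map_injective_iff.2 ?_) this)
    exact Fin.val_injective.comp (Equiv.injective _)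
  all_goals
    simp only [List.mem_map]
    rintro _ ⟨s, -, rfl⟩
    omega

variable [DecidableEq α]

/-- The encoding of the initial half of the reduced word of `x`. -/
noncomputable def halfValue (x : FreeGroup α) : ℕ :=
  wordValue (x.toWord.take (norm x / 2))

theorem halfValue_mul_lt {h : ℕ} {x y : FreeGroup α} (hx : norm x = 2 * h) (hy : 2 * h ≤ norm y)
    (hxy : CommonPrefix h x⁻¹ y) (hle : norm y ≤ norm (x * y))
    (hlt : wordValue (x.toWord.take h) < wordValue (x⁻¹.toWord.take h)) :
    halfValue (x * y) + halfValue (x * y)⁻¹ < halfValue y + halfValue y⁻¹ := by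
  set p := x.toWord.take h with hp
  set b := y.toWord.drop h with hb
  have hplen : p.length = h := by
    simp only [hp, List.length_take, norm] at hx ⊢
    omega
  have hblen : b.length + h = norm y := by
    simp only [hb, List.length_drop, norm] at hy ⊢
    omega
  have hprod : x * y = mk (p ++ b) := by
    have := inv_mul_eq_mk hxy.2.2
    rw [inv_inv] at this
    rw [this, toWord_inv]
    congr 2
    conv_lhs => rw [← List.take_append_drop h x.toWord, invRev_append]
    have hlen : (invRev (x.toWord.drop h)).length = h := by
      simp only [invRev_length, List.length_drop, norm] at hx ⊢
      omega
    rw [List.drop_left' hlen, invRev_invRev]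
  have hword : (x * y).toWord = p ++ b := by
    rw [hprod]
    refine toWord_mk_of_length_le ?_
    rw [← hprod, List.length_append]
    omega
  have hyword : y.toWord = x⁻¹.toWord.take h ++ b := by
    rw [hxy.2.2, List.take_append_drop]
  have hqlen : (x⁻¹.toWord.take h).length = h := by
    have := norm_inv_eq (x := x)
    simp only [List.length_take, norm] at this hx ⊢
    omega
  set q := x⁻¹.toWord.take h
  have hnorm : norm (x * y) = norm y := by
    rw [norm, hword, List.length_append]
    omega
  have h₁ : halfValue (x * y) < halfValue y := by
    rw [halfValue, halfValue, hnorm, hword, hyword, List.take_append,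
      List.take_append, hplen, hqlen, List.take_of_length_le (l := p) (by omega),
      List.take_of_length_le (l := q) (by omega), wordValue_append, wordValue_append]
    gcongr
  have h₂ : halfValue (x * y)⁻¹ = halfValue y⁻¹ := by
    rw [halfValue, halfValue, norm_inv_eq, norm_inv_eq, hnorm, toWord_inv, toWord_inv, hword,
      hyword, invRev_append, invRev_append, List.take_append_of_le_length,
      List.take_append_of_le_length] <;> (rw [invRev_length]; omega)
  omega

end WordValue

section NielsenReduced

variable {α : Type*}

/-- The letter of the free group given by a generator and a sign. -/
def letter (s : α × Bool) : FreeGroup α := mk [s]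

theorem letter_true (a : α) : letter (a, true) = of a := rfl

theorem letter_false (a : α) : letter (a, false) = (of a)⁻¹ := rfl

/-- The index of the inverse letter. -/
def flip (s : α × Bool) : α × Bool := (s.1, !s.2)

theorem letter_flip (s : α × Bool) : letter (flip s) = (letter s)⁻¹ := by
  simp [letter, flip, inv_mk, invRev]

@[simp]
theorem flip_flip (s : α × Bool) : flip (flip s) = s := by simp [flip]

theorem ne_flip_iff {s t : α × Bool} : t ≠ flip s ↔ (s.1 = t.1 → s.2 = t.2) := by
  obtain ⟨a, i⟩ := s
  obtain ⟨b, j⟩ := t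
  cases i <;> cases j <;> simp [flip, eq_comm]

theorem fst_ne_or_eq_of_ne_flip {s t : α × Bool} (h : t ≠ flip s) : s.1 ≠ t.1 ∨ s = t := by
  by_cases hst : s.1 = t.1
  · exact .inr (Prod.ext hst (ne_flip_iff.1 h hst))
  · exact .inl hst

theorem prod_map_letter (L : List (α × Bool)) : (L.map letter).prod = mk L := by
  induction L with
  | nil => rfl
  | cons s L ih => rw [List.map_cons, List.prod_cons, ih, letter, mul_mk, List.singleton_append]

variable [DecidableEq α]

/-- A family of elements of a free group, indexed by signed letters, is Nielsen reduced if no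
element is trivial and no element is cancelled in a product of two or three elements. -/
structure IsNielsenReduced {ι : Type*} (u : ι × Bool → FreeGroup α) : Prop where
  ne_one (i : ι × Bool) : u i ≠ 1
  norm_le (i j : ι × Bool) : j ≠ flip i → norm (u i) ≤ norm (u i * u j)
  norm_add_norm_lt (i j k : ι × Bool) : j ≠ flip i → k ≠ flip j →
    norm (u i) + norm (u k) < norm (u i * u j) + norm (u j * u k)

variable {ι : Type*} {u : ι × Bool → FreeGroup α}

theorem IsNielsenReduced.norm_prod (hu : IsNielsenReduced u) {i : ι × Bool}
    {L : List (ι × Bool)} (hL : IsReduced (i :: L)) :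
    (∀ k, i ≠ flip k → norm (u k) + norm (L.map u).prod <
      norm (u k * u i) + norm (u i * (L.map u).prod)) ∧
    norm (u i) + L.length ≤ norm (u i * (L.map u).prod) + norm (L.map u).prod := by
  induction L generalizing i with
  | nil =>
    have h (i) : 0 < norm (u i) := Nat.pos_of_ne_zero (norm_eq_zero.not.2 (hu.ne_one i))
    simp only [List.map_nil, List.prod_nil, norm_one, mul_one, List.length_nil, add_zero, le_refl,
      and_true]
    intro k hk
    have := hu.norm_le k i hk
    have := h i
    omega
  | cons j L ih =>
    rw [isReduced_cons_cons, ← ne_flip_iff] at hL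
    obtain ⟨h₁, h₂⟩ := ih hL.2
    have h₃ := h₁ i hL.1
    have h₄ := norm_mul_add_norm_of_lt (x := u i) (y := u j) (z := u j * (L.map u).prod)
      (by rwa [inv_mul_cancel_left])
    simp only [List.map_cons, List.prod_cons, List.length_cons]
    refine ⟨fun k hk ↦ ?_, by omega⟩
    have := hu.norm_add_norm_lt k i j hk hL.1
    omega

theorem IsNielsenReduced.eq_nil_of_norm_eq_one (hu : IsNielsenReduced u) {i : ι × Bool}
    {L : List (ι × Bool)} (hL : IsReduced (i :: L))
    (h : norm (((i :: L).map u).prod) = 1) : L = [] := by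
  obtain ⟨h₁, h₂⟩ := hu.norm_prod hL
  have h₃ := h₁ i (ne_flip_iff.2 fun _ ↦ rfl)
  have h₄ := norm_mul_le (u i) (u i)
  obtain ⟨n, hn⟩ := exists_norm_mul_add (u i) (L.map u).prod
  rw [List.map_cons, List.prod_cons] at h
  rw [← List.length_eq_zero_iff]
  omega

end NielsenReduced

section Minimal

variable {α ι : Type*} [DecidableEq α] [Fintype α] {u : ι × Bool → FreeGroup α}

theorem isNielsenReduced_of_minimal (hu_inv : ∀ s, u (flip s) = (u s)⁻¹) (hu_ne : ∀ s, u s ≠ 1)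
    (hmin : ∀ s t, s.1 ≠ t.1 → norm (u s) ≤ norm (u t * u s) ∧
      (norm (u s) = norm (u t * u s) → halfValue (u s) + halfValue (u s)⁻¹ ≤
        halfValue (u t * u s) + halfValue (u t * u s)⁻¹)) : IsNielsenReduced u := by
  have norm_flip (s) : norm (u (flip s)) = norm (u s) := by rw [hu_inv, norm_inv_eq]
  have norm_flip_mul (s t) : norm (u (flip t) * u (flip s)) = norm (u s * u t) := by
    rw [hu_inv, hu_inv, ← mul_inv_rev, norm_inv_eq]
  have right_le (s t) (h : t ≠ flip s) : norm (u t) ≤ norm (u s * u t) := by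
    obtain h | rfl := fst_ne_or_eq_of_ne_flip h
    · exact (hmin t s h.symm).1
    · exact (norm_lt_norm_mul_self (hu_ne s)).le
  have left_le (s t) (h : t ≠ flip s) : norm (u s) ≤ norm (u s * u t) := by
    rw [← norm_flip s, ← norm_flip_mul]
    exact right_le _ _ fun h' ↦ h (by rw [h', flip_flip])
  have fst_ne (s t) (h : t ≠ flip s) (h' : norm (u s * u t) = norm (u s)) : s.1 ≠ t.1 := by
    obtain h | rfl := fst_ne_or_eq_of_ne_flip h
    · exact h
    · exact absurd h' (norm_lt_norm_mul_self (hu_ne s)).ne'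
  have value_le {n : ℕ} (s t) (hst : s.1 ≠ t.1) (hs : norm (u s) = 2 * n)
      (h : norm (u s * u t) = norm (u t)) (hle : norm (u s) ≤ norm (u t)) :
      wordValue ((u s)⁻¹.toWord.take n) ≤ wordValue ((u s).toWord.take n) := by
    by_contra! hlt
    have hcp : CommonPrefix n (u s)⁻¹ (u t) := by
      rw [commonPrefix_iff, inv_inv, norm_inv_eq]
      omega
    exact ((hmin t s hst.symm).2 h.symm).not_gt
      (halfValue_mul_lt hs (by omega) hcp h.ge hlt)
  refine ⟨hu_ne, left_le, fun i j k hij hjk ↦ ?_⟩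
  by_contra! hle
  have h₁ := left_le i j hij
  have h₂ := right_le j k hjk
  have h₃ := right_le i j hij
  have h₄ := left_le j k hjk
  have hi : norm (u i * u j) = norm (u i) := by omega
  have hk : norm (u j * u k) = norm (u k) := by omega
  have hij' : i.1 ≠ j.1 := fst_ne i j hij hi
  have hjk' : k.1 ≠ j.1 := by
    refine fst_ne (flip k) (flip j) (fun h ↦ hjk ?_) ?_
    · simpa using h.symm
    · rw [norm_flip_mul, norm_flip, hk]
  obtain ⟨n, hn⟩ := exists_norm_mul_add (u i) (u j)
  have hj : norm (u j) = 2 * n := by omega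
  have hv₁ := value_le j k hjk'.symm hj hk (by omega)
  have hv₂ := value_le (n := n) (flip j) (flip i) hij'.symm (by rw [norm_flip, hj])
    (by rw [norm_flip_mul, norm_flip, hi]) (by rw [norm_flip, norm_flip]; omega)
  rw [hu_inv, inv_inv] at hv₂
  have heq := wordValue_injOn_length (by simp) (hv₁.antisymm hv₂)
  apply hu_ne j
  have hcp : CommonPrefix n (u j)⁻¹ (u j) := ⟨by rw [norm_inv_eq]; omega, by omega, heq⟩
  rw [commonPrefix_iff, norm_inv_eq, inv_inv] at hcp
  by_contra hne
  have := norm_lt_norm_mul_self hne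
  omega

end Minimal

section Automorphisms

variable {A : Type*}

theorem mulAut_ext {φ ψ : MulAut (FreeGroup A)} (h : ∀ x, φ (of x) = ψ (of x)) : φ = ψ :=
  MulEquiv.toMonoidHom_injective (ext_hom _ _ h)

/-- An automorphism given by its values on generators and those of its inverse. -/
def mulAutOfLift (f g : A → FreeGroup A) (hfg : ∀ x, lift f (g x) = of x)
    (hgf : ∀ x, lift g (f x) = of x) : MulAut (FreeGroup A) :=
  (lift f).toMulEquiv (lift g) (ext_hom _ _ fun x ↦ by simpa using hgf x)
    (ext_hom _ _ fun x ↦ by simpa using hfg x)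

theorem mulAutOfLift_of (f g : A → FreeGroup A) (hfg hgf) (x : A) :
    mulAutOfLift f g hfg hgf (of x) = f x := by
  simp [mulAutOfLift]

variable (A) in
/-- The group of automorphisms generated by the elementary Nielsen automorphisms. -/
def nielsenSubgroup : Subgroup (MulAut (FreeGroup A)) :=
  Subgroup.closure
      {φ : MulAut (FreeGroup A) |
        (∃ a : A, φ (FreeGroup.of a) = (FreeGroup.of a)⁻¹ ∧
          ∀ x : A, x ≠ a → φ (FreeGroup.of x) = FreeGroup.of x) ∨
        (∃ a b : A, a ≠ b ∧ φ (FreeGroup.of a) = FreeGroup.of a * FreeGroup.of b ∧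
          ∀ x : A, x ≠ a → φ (FreeGroup.of x) = FreeGroup.of x)}

theorem exists_mem_nielsenSubgroup_inv (a : A) : ∃ φ ∈ nielsenSubgroup A,
    φ (of a) = (of a)⁻¹ ∧ ∀ x, x ≠ a → φ (of x) = of x := by
  classical
  let f : A → FreeGroup A := fun x ↦ if x = a then (of x)⁻¹ else of x
  have hf (x) : lift f (f x) = of x := by by_cases h : x = a <;> simp [f, h]
  have h : mulAutOfLift f f hf hf (of a) = (of a)⁻¹ ∧
      ∀ x, x ≠ a → mulAutOfLift f f hf hf (of x) = of x :=
    ⟨by simp [mulAutOfLift_of, f], fun x hx ↦ by simp [mulAutOfLift_of, f, hx]⟩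
  exact ⟨_, Subgroup.subset_closure (.inl ⟨a, h⟩), h⟩

theorem exists_mem_nielsenSubgroup_mul {a b : A} (hab : a ≠ b) : ∃ φ ∈ nielsenSubgroup A,
    φ (of a) = of a * of b ∧ ∀ x, x ≠ a → φ (of x) = of x := by
  classical
  let f : A → FreeGroup A := fun x ↦ if x = a then of x * of b else of x
  let g : A → FreeGroup A := fun x ↦ if x = a then of x * (of b)⁻¹ else of x
  have hfg (x) : lift f (g x) = of x := by by_cases h : x = a <;> simp [f, g, h, hab.symm]
  have hgf (x) : lift g (f x) = of x := by by_cases h : x = a <;> simp [f, g, h, hab.symm]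
  have h : mulAutOfLift f g hfg hgf (of a) = of a * of b ∧
      ∀ x, x ≠ a → mulAutOfLift f g hfg hgf (of x) = of x :=
    ⟨by simp [mulAutOfLift_of, f], fun x hx ↦ by simp [mulAutOfLift_of, f, hx]⟩
  exact ⟨_, Subgroup.subset_closure (.inr ⟨a, b, hab, h⟩), h⟩

theorem exists_mem_nielsenSubgroup_letter_mul {s t : A × Bool} (hst : s.1 ≠ t.1) :
    ∃ φ ∈ nielsenSubgroup A, φ (letter s) = letter t * letter s ∧
      ∀ x, x ≠ s.1 → φ (of x) = of x := by
  obtain ⟨a, i⟩ := s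
  obtain ⟨b, j⟩ := t
  replace hst : a ≠ b := hst
  obtain ⟨σ, hσ, hσa, hσx⟩ := exists_mem_nielsenSubgroup_inv a
  obtain ⟨β, hβ, hβa, hβx⟩ := exists_mem_nielsenSubgroup_mul hst
  have hσb := hσx b hst.symm
  have hβb := hβx b hst.symm
  have hβx' (x) (hx : x ≠ a) : β⁻¹ (of x) = of x := β.symm_apply_eq.2 (hβx x hx).symm
  have hβa' : β⁻¹ (of a) = of a * (of b)⁻¹ := β.symm_apply_eq.2 (by simp [hβa, hβb])
  cases i <;> cases j <;> simp only [letter_true, letter_false]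
  · exact ⟨β, hβ, by simp [hβa], hβx⟩
  · exact ⟨β⁻¹, inv_mem hβ, by simp only [_root_.map_inv, hβa']; simp, hβx'⟩
  · exact ⟨σ * β * σ, mul_mem (mul_mem hσ hβ) hσ, by simp [hσa, hβa, hσb],
      fun x hx ↦ by simp [hσx x hx, hβx x hx]⟩
  · refine ⟨σ * β⁻¹ * σ, mul_mem (mul_mem hσ (inv_mem hβ)) hσ, ?_, fun x hx ↦ ?_⟩
    · simp only [MulAut.mul_apply, hσa, _root_.map_inv, hβa', _root_.map_mul, hσb]
      simp
    · simp only [MulAut.mul_apply, hσx x hx, hβx' x hx]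

theorem freeGroupCongr_swap_mem_nielsenSubgroup [DecidableEq A] {a b : A} (hab : a ≠ b) :
    (freeGroupCongr (Equiv.swap a b) : MulAut (FreeGroup A)) ∈ nielsenSubgroup A := by
  obtain ⟨f, hf, hfa, hfx⟩ :=
    exists_mem_nielsenSubgroup_letter_mul (s := (a, true)) (t := (b, true)) hab
  obtain ⟨g, hg, hgb, hgx⟩ :=
    exists_mem_nielsenSubgroup_letter_mul (s := (b, true)) (t := (a, false)) hab.symm
  obtain ⟨k, hk, hka, hkx⟩ :=
    exists_mem_nielsenSubgroup_letter_mul (s := (a, false)) (t := (b, false)) hab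
  obtain ⟨σ, hσ, hσb, hσx⟩ := exists_mem_nielsenSubgroup_inv b
  simp only [letter_true, letter_false] at hfa hgb hka
  rw [_root_.map_inv, ← mul_inv_rev, inv_inj] at hka
  have : (freeGroupCongr (Equiv.swap a b) : MulAut (FreeGroup A)) = f * g * k * σ := by
    refine mulAut_ext fun x ↦ ?_
    by_cases hxa : x = a
    · subst hxa
      simp [hσx x hab, hka, hgx x hab, hgb, hfx b hab.symm]
    by_cases hxb : x = b
    · subst hxb
      simp [hσb, hkx x hxa, hgb, hfa, hfx x hxa]
    · simp [Equiv.swap_apply_of_ne_of_ne hxa hxb, hσx x hxb, hkx x hxa, hgx x hxb, hfx x hxa]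
  rw [this]
  exact mul_mem (mul_mem (mul_mem hf hg) hk) hσ

theorem exists_mem_nielsenSubgroup_sign [DecidableEq A] (S : Finset A) :
    ∃ φ ∈ nielsenSubgroup A, ∀ x, φ (of x) = if x ∈ S then (of x)⁻¹ else of x := by
  induction S using Finset.induction_on with
  | empty => exact ⟨1, one_mem _, by simp⟩
  | insert a S ha ih =>
    obtain ⟨φ, hφ, hφx⟩ := ih
    obtain ⟨σ, hσ, hσa, hσx⟩ := exists_mem_nielsenSubgroup_inv a
    refine ⟨φ * σ, mul_mem hφ hσ, fun x ↦ ?_⟩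
    by_cases hx : x = a
    · subst hx
      simp [hσa, hφx, ha]
    · simp [hσx x hx, hφx, hx]

theorem freeGroupCongr_mem_nielsenSubgroup [Finite A] (e : Equiv.Perm A) :
    (freeGroupCongr e : MulAut (FreeGroup A)) ∈ nielsenSubgroup A := by
  classical
  induction e using Equiv.Perm.swap_induction_on with
  | one =>
    convert one_mem (nielsenSubgroup A)
    exact freeGroupCongr_refl
  | swap_mul e x y hxy ih =>
    convert mul_mem (freeGroupCongr_swap_mem_nielsenSubgroup hxy) ih
    exact (freeGroupCongr_trans e (Equiv.swap x y)).symm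

theorem mem_nielsenSubgroup_of_forall_exists_letter [Finite A] {ψ : MulAut (FreeGroup A)}
    (h : ∀ x, ∃ s, ψ (letter s) = of x) : ψ ∈ nielsenSubgroup A := by
  classical
  choose s hs using h
  have hs' (x) : ψ⁻¹ (of x) = letter (s x) := ψ.symm_apply_eq.2 (hs x).symm
  have hinj : Function.Injective fun x ↦ (s x).1 := by
    intro x y hxy
    by_cases h2 : (s x).2 = (s y).2
    · exact of_injective (by rw [← hs x, ← hs y, Prod.ext hxy h2])
    · have : s x = flip (s y) := Prod.ext hxy (by simpa [flip] using Bool.eq_not.2 h2)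
      have : of x = (of y)⁻¹ := by rw [← hs x, ← hs y, this, letter_flip, _root_.map_inv]
      have := congrArg toWord this
      simp [toWord_inv, invRev] at this
  let e : Equiv.Perm A := Equiv.ofBijective _ (Finite.injective_iff_bijective.1 hinj)
  cases nonempty_fintype A
  obtain ⟨θ, hθ, hθx⟩ := exists_mem_nielsenSubgroup_sign {x | (s x).2 = false}
  have : ψ⁻¹ = (freeGroupCongr e : MulAut (FreeGroup A)) * θ := by
    refine mulAut_ext fun x ↦ ?_
    rw [hs', MulAut.mul_apply, hθx]
    have he : e x = (s x).1 := rfl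
    rcases hsx : s x with ⟨a, _ | _⟩ <;> simp [hsx, he, letter, of, inv_mk, invRev]
  rw [← inv_mem_iff, this]
  exact mul_mem (freeGroupCongr_mem_nielsenSubgroup e) hθ

theorem sum_apply_mul_add [Fintype A] {w : FreeGroup A → ℕ} (hw : ∀ g, w g⁻¹ = w g)
    {ψ φ : MulAut (FreeGroup A)} {s t : A × Bool} (hs : φ (letter s) = letter t * letter s)
    (hx : ∀ x, x ≠ s.1 → φ (of x) = of x) :
    ∑ x, w ((ψ * φ) (of x)) + w (ψ (letter s)) =
      ∑ x, w (ψ (of x)) + w (ψ (letter t) * ψ (letter s)) := by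
  classical
  have hw' (χ : MulAut (FreeGroup A)) : w (χ (of s.1)) = w (χ (letter s)) := by
    obtain ⟨a, i⟩ := s
    cases i
    · rw [← hw, ← _root_.map_inv]
      rfl
    · rfl
  rw [← Finset.add_sum_erase _ _ (Finset.mem_univ s.1),
    ← Finset.add_sum_erase _ (fun x ↦ w (ψ (of x))) (Finset.mem_univ s.1), hw', hw',
    MulAut.mul_apply, hs, _root_.map_mul, Finset.sum_congr rfl fun x h ↦ by
      rw [MulAut.mul_apply, hx x (Finset.ne_of_mem_erase h)]]
  ring

theorem nielsenSubgroup_eq_top [Finite A] : nielsenSubgroup A = ⊤ := by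
  classical
  cases nonempty_fintype A
  refine (Subgroup.eq_top_iff' _).2 fun φ ↦ ?_
  let v (g : FreeGroup A) : ℕ := halfValue g + halfValue g⁻¹
  have hv (g) : v g⁻¹ = v g := by simp only [v, inv_inv, add_comm]
  let f (ψ : MulAut (FreeGroup A)) : ℕ ×ₗ ℕ :=
    toLex (∑ x, norm (ψ (of x)), ∑ x, v (ψ (of x)))
  obtain ⟨η, hη, hmin⟩ := WellFounded.has_min (InvImage.wf (fun η ↦ f (φ * η)) wellFounded_lt)
    (nielsenSubgroup A : Set (MulAut (FreeGroup A))) ⟨1, one_mem _⟩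
  set ψ := φ * η with hψ
  have hred : IsNielsenReduced fun s ↦ ψ (letter s) := by
    refine isNielsenReduced_of_minimal (fun s ↦ by rw [letter_flip, _root_.map_inv])
      (fun s ↦ ?_) (fun s t hst ↦ ?_)
    · rw [Ne, EmbeddingLike.map_eq_one_iff, letter, ← toWord_eq_nil_iff, toWord_mk]
      simp
    · obtain ⟨χ, hχ, hχs, hχx⟩ := exists_mem_nielsenSubgroup_letter_mul hst
      have h := hmin (η * χ) (mul_mem hη hχ)
      simp only [InvImage, ← mul_assoc, ← hψ, f, Prod.Lex.toLex_lt_toLex] at h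
      have h₁ := sum_apply_mul_add (fun g ↦ norm_inv_eq) (ψ := ψ) hχs hχx
      have h₂ := sum_apply_mul_add hv (ψ := ψ) hχs hχx
      change _ ∧ (_ → v _ ≤ v _)
      omega
  suffices ψ ∈ nielsenSubgroup A from (Subgroup.mul_mem_cancel_right _ hη).1 this
  refine mem_nielsenSubgroup_of_forall_exists_letter fun x ↦ ?_
  have hprod : (((ψ⁻¹ (of x)).toWord).map fun s ↦ ψ (letter s)).prod = of x := by
    have := congrArg ψ ((prod_map_letter (ψ⁻¹ (of x)).toWord).trans mk_toWord)
    rwa [map_list_prod, List.map_map, MulAut.apply_inv_self] at this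
  have hword := isReduced_toWord (x := ψ⁻¹ (of x))
  generalize (ψ⁻¹ (of x)).toWord = W at hprod hword
  obtain - | ⟨i, L⟩ := W
  · exact absurd hprod (one_ne_of x)
  · obtain rfl := hred.eq_nil_of_norm_eq_one hword (by rw [hprod, norm_of])
    exact ⟨i, by simpa using hprod⟩

end Automorphisms

end FreeGroup

/-- (Nielsen) For a finite set `A` with `|A| ≥ 2`, the elementary Nielsen
automorphisms `α_a : a ↦ a⁻¹` and `β_{ab} : a ↦ ab` (for distinct `a, b ∈ A`, fixing all
other generators) generate `Aut(F_A)` as a group. -/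
theorem stmt_19 (A : Type) [Fintype A] (hA : 2 ≤ Fintype.card A) :
    Subgroup.closure
      {φ : MulAut (FreeGroup A) |
        (∃ a : A, φ (FreeGroup.of a) = (FreeGroup.of a)⁻¹ ∧
          ∀ x : A, x ≠ a → φ (FreeGroup.of x) = FreeGroup.of x) ∨
        (∃ a b : A, a ≠ b ∧ φ (FreeGroup.of a) = FreeGroup.of a * FreeGroup.of b ∧
          ∀ x : A, x ≠ a → φ (FreeGroup.of x) = FreeGroup.of x)} = ⊤ :=
  FreeGroup.nielsenSubgroup_eq_top
end
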